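/- If every u ∈ 𝔽 with R(u) + R*(u) = 0 lies in F_q, then the degree [F_q : F_p] is even. -/

import Mathlib

open Finset

open scoped Classical

noncomputable section

/-- Length-two Witt vectors, with the operations specialised to characteristic two. -/
def W2 (R : Type*) := R × R

namespace W2

variable {R : Type*} [CommRing R]

instance : Zero (W2 R) := ⟨((0, 0) : R × R)⟩

instance : Add (W2 R) := ⟨fun x y => ((x.1 + y.1, x.2 + y.2 + x.1 * y.1) : R × R)⟩

instance [CharP R 2] : Neg (W2 R) := ⟨fun x => ((x.1, x.2 + x.1 * x.1) : R × R)⟩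

theorem fst_add (x y : W2 R) : (x + y).1 = x.1 + y.1 := rfl
theorem snd_add (x y : W2 R) : (x + y).2 = x.2 + y.2 + x.1 * y.1 := rfl
theorem fst_zero : (0 : W2 R).1 = 0 := rfl
theorem snd_zero : (0 : W2 R).2 = 0 := rfl
theorem fst_neg [CharP R 2] (x : W2 R) : (-x).1 = x.1 := rfl
theorem snd_neg [CharP R 2] (x : W2 R) : (-x).2 = x.2 + x.1 * x.1 := rfl

instance [CharP R 2] : AddCommGroup (W2 R) where
  add := (· + ·)
  zero := 0
  neg := Neg.neg
  add_assoc a b c := Prod.ext_iff.mpr (by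
    constructor <;> simp only [fst_add, snd_add] <;> ring)
  zero_add a := Prod.ext_iff.mpr (by
    constructor <;> simp [fst_add, snd_add, fst_zero, snd_zero])
  add_zero a := Prod.ext_iff.mpr (by
    constructor <;> simp [fst_add, snd_add, fst_zero, snd_zero])
  add_comm a b := Prod.ext_iff.mpr (by
    constructor <;> simp only [fst_add, snd_add] <;> ring)
  neg_add_cancel a := Prod.ext_iff.mpr (by
    constructor
    · simp only [fst_add, fst_neg, fst_zero]
      exact CharTwo.add_self_eq_zero a.1
    · simp only [snd_add, snd_neg, snd_zero, fst_neg]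
      rw [show a.2 + a.1 * a.1 + a.2 + a.1 * a.1
            = (a.2 + a.2) + (a.1 * a.1 + a.1 * a.1) by ring]
      rw [CharTwo.add_self_eq_zero, CharTwo.add_self_eq_zero, add_zero])
  nsmul := nsmulRec
  zsmul := zsmulRec

/-- Frobenius on length-two Witt vectors (characteristic two). -/
def frob (x : W2 R) : W2 R := ((x.1 ^ 2, x.2 ^ 2) : R × R)

/-- The Witt-vector trace `Tr_{q/2} = ∑_{i=0}^{n-1} Frobⁱ`. -/
def tr [CharP R 2] (n : ℕ) (x : W2 R) : W2 R := ∑ i ∈ Finset.range n, frob^[i] x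

/-- The additive character of `W₂(𝔽₂)` determined by `ξ₂(1,0) = I`
(for `I` a fixed primitive fourth root of unity), evaluated on Witt vectors
whose components lie in the prime field `𝔽₂ = {0,1}`. -/
def xi (I : ℂ) (x : W2 R) : ℂ := (if x.1 = 0 then 1 else I) * (if x.2 = 0 then 1 else -1)

end W2

variable {K : Type*}

/-- The absolute trace `Tr_{q/2} : 𝔽_q → 𝔽₂`, computed inside `K` (here `q = 2^n`). -/
def tr2 [Field K] (n : ℕ) (x : K) : K := ∑ i ∈ Finset.range n, x ^ 2 ^ i

/-- The relative trace `Tr_{q/p} : 𝔽_q → 𝔽_p ⊆ 𝔽_q`, computed inside `K`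
(here `q = p^m`). -/
def trp [Field K] (p m : ℕ) (x : K) : K := ∑ i ∈ Finset.range m, x ^ p ^ i

/-- The character `ψ_q(x) = (-1)^{Tr_{q/2}(x)}`. -/
def psiq [Field K] (n : ℕ) (x : K) : ℂ := if tr2 n x = 0 then 1 else -1

/-- The map `Q_q(x) = ξ₂(Tr_{q/2}(x,0))` on Witt vectors of length two. -/
def Qq [Field K] [CharP K 2] (I : ℂ) (n : ℕ) (x : K) : ℂ :=
  W2.xi I (W2.tr n (((x, 0) : K × K) : W2 K))

/-- The unique `2^j`-th root in a perfect field of characteristic two. -/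
def rt (L : Type*) [Field L] [ExpChar L 2] [PerfectRing L 2] (j : ℕ) (x : L) : L :=
  (fun y => (frobeniusEquiv L 2).symm y)^[j] x

/-- Evaluation of the `𝔽_p`-linearised polynomial `∑_{i=0}^{e} c_i x^{p^i}`. -/
def Lpoly [Field K] (p e : ℕ) (c : ℕ → K) (x : K) : K :=
  ∑ i ∈ Finset.range (e + 1), c i * x ^ p ^ i

/-- The adjoint `f^*(x) = ∑_{i=0}^{e} (c_i x)^{p^{-i}}` (with `p = 2^k`). -/
def adj [Field K] [ExpChar K 2] [PerfectRing K 2] (k e : ℕ) (c : ℕ → K) (x : K) : K :=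
  ∑ i ∈ Finset.range (e + 1), rt K (k * i) (c i * x)

/-- Evaluation of the `𝔽_p`-linearised polynomial `∑_{i=1}^{e} c_i x^{p^i}`
(no constant-in-`x` coefficient). -/
def LpolyIcc [Field K] (p e : ℕ) (c : ℕ → K) (x : K) : K :=
  ∑ i ∈ Finset.Icc 1 e, c i * x ^ p ^ i

/-- The adjoint `R^*(x) = ∑_{i=1}^{e} (c_i x)^{p^{-i}}` (with `p = 2^k`). -/
def adjIcc [Field K] [ExpChar K 2] [PerfectRing K 2] (k e : ℕ) (c : ℕ → K) (x : K) : K :=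
  ∑ i ∈ Finset.Icc 1 e, rt K (k * i) (c i * x)

/-- The coefficients `a_i = ∑_{j=0}^{e-i} (b_j b_{j+i})^{p^{-j}}` of `R_F` (with `p = 2^k`). -/
def aRF [Field K] [ExpChar K 2] [PerfectRing K 2] (k e : ℕ) (b : ℕ → K) (i : ℕ) : K :=
  ∑ j ∈ Finset.range (e - i + 1), rt K (k * j) (b j * b (j + i))

/-- The linearised polynomial `R_F(x) = ∑_{i=1}^{e} a_i x^{p^i}` (with `p = 2^k`). -/
def RF [Field K] [ExpChar K 2] [PerfectRing K 2] (k e : ℕ) (b : ℕ → K) (x : K) : K :=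
  ∑ i ∈ Finset.Icc 1 e, aRF k e b i * x ^ (2 ^ k) ^ i

/-- `γ_F = ∑_{0 ≤ i < j ≤ e} b_i^{p^{-i}} b_j^{p^{-j}}` (with `p = 2^k`). -/
def gammaF [Field K] [ExpChar K 2] [PerfectRing K 2] (k e : ℕ) (b : ℕ → K) : K :=
  ∑ i ∈ Finset.range (e + 1), ∑ j ∈ Finset.Ioo i (e + 1), rt K (k * i) (b i) * rt K (k * j) (b j)

/-- `α_F(t) = γ_F + F^*(t)²`. -/
def alphaF [Field K] [ExpChar K 2] [PerfectRing K 2] (k e : ℕ) (b : ℕ → K) (t : K) : K :=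
  gammaF k e b + adj k e b t ^ 2

/-- `R_{F,t}(x) = R_F(x) + α_F(t) x`. -/
def RFt [Field K] [ExpChar K 2] [PerfectRing K 2] (k e : ℕ) (b : ℕ → K) (t x : K) : K :=
  RF k e b x + alphaF k e b t * x

/-- The number of affine points of the van der Geer–van der Vlugt curve
`y^p - y = x R(x)` with coordinates in `K`. -/
def Ncount (K : Type*) [Field K] (p : ℕ) (R : K → K) : ℕ :=
  Nat.card {z : K × K // z.2 ^ p - z.2 = z.1 * R z.1}

/-- The adjoint `F^*` of `F(x) = ∑_{i=0}^{e} b_i x^{p^i}`, with coefficients `b_i ∈ K`,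
viewed as a function on the algebraic closure `𝔽` of `K`. -/
def adjBar [Field K] [CharP K 2] (k e : ℕ) (b : ℕ → K) (x : AlgebraicClosure K) : AlgebraicClosure K :=
  adj k e (fun i => algebraMap K (AlgebraicClosure K) (b i)) x

/-- `F(x) = ∑_{i=0}^{e} b_i x^{p^i}`, with coefficients `b_i ∈ K`, viewed as a function on
the algebraic closure `𝔽` of `K` (with `p = 2^k`). -/
def LpolyBar [Field K] [CharP K 2] (k e : ℕ) (b : ℕ → K) (x : AlgebraicClosure K) : AlgebraicClosure K :=
  Lpoly (2 ^ k) e (fun i => algebraMap K (AlgebraicClosure K) (b i)) x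


/-- Parity of the rank of an alternating form. -/
theorem alt_parity_aux.{w} {F : Type*} [Field F] (n : ℕ) : ∀ {V : Type w} [AddCommGroup V] [Module F V]
    [FiniteDimensional F V] (B : V →ₗ[F] V →ₗ[F] F), (∀ x, B x x = 0) →
    Module.finrank F V = n → Even (Module.finrank F V + Module.finrank F (LinearMap.ker B)) := by
  induction n using Nat.strong_induction_on with
  | _ n ih =>
    intro V _ _ _ B hB hn
    have hskew : ∀ x y, B x y = - B y x := by
      intro x y
      have h := hB (x + y)
      simp only [map_add, LinearMap.add_apply, hB, zero_add, add_zero] at h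
      exact eq_neg_of_add_eq_zero_right h
    by_cases h0 : B = 0
    · subst h0
      rw [LinearMap.ker_zero, finrank_top]
      exact ⟨_, rfl⟩
    · have : ∃ x y, B x y ≠ 0 := by
        by_contra! h
        exact h0 (LinearMap.ext fun x => LinearMap.ext fun y => h x y)
      obtain ⟨x, y, hxy⟩ := this
      have hyx : B y x ≠ 0 := by rw [hskew]; exact neg_ne_zero.mpr hxy
      let f : V →ₗ[F] F × F := (B x).prod (B y)
      have hf : Function.Surjective f := by
        rintro ⟨a, b⟩
        refine ⟨(a / B x y) • y + (b / B y x) • x, ?_⟩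
        simp [f, hB, hxy, hyx]
      have hr := LinearMap.finrank_range_add_finrank_ker f
      rw [LinearMap.range_eq_top.mpr hf, finrank_top, Module.finrank_prod, Module.finrank_self] at hr
      let W := LinearMap.ker f
      have hW : ∀ w, w ∈ W ↔ B x w = 0 ∧ B y w = 0 := by
        intro w; simp [W, f]
      let BW : W →ₗ[F] W →ₗ[F] F := B.domRestrict₁₂ W W
      have hBW : ∀ a b, BW a b = B a b := fun a b => rfl
      have key := ih (Module.finrank F W) (by change Module.finrank F (LinearMap.ker f) < n; omega) BW (fun w => hB _) rfl
      have hle : LinearMap.ker B ≤ W := by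
        intro w hw
        rw [LinearMap.mem_ker] at hw
        rw [hW, hskew, hskew y, hw]; simp
      have hker : LinearMap.ker BW = Submodule.comap W.subtype (LinearMap.ker B) := by
        ext w
        simp only [LinearMap.mem_ker, Submodule.mem_comap, Submodule.subtype_apply]
        constructor
        · intro h
          ext v
          have hw := (hW w).1 w.2
          have hwx : B w x = 0 := by rw [hskew, hw.1, neg_zero]
          have hwy : B w y = 0 := by rw [hskew, hw.2, neg_zero]
          have hv : v - (B x v / B x y) • y - (B y v / B y x) • x ∈ W := by
            rw [hW]; simp [hB, hxy, hyx]
          have := LinearMap.congr_fun h ⟨_, hv⟩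
          rw [hBW] at this
          simpa [hwx, hwy] using this
        · intro h
          ext v
          rw [hBW, h]; rfl
      rw [hker, (Submodule.comapSubtypeEquivOfLe hle).finrank_eq] at key
      rw [← hr]
      change Even (1 + 1 + Module.finrank F W + _)
      rw [Nat.even_iff] at key ⊢
      omega

open Polynomial in
/-- The separable polynomial `(R + R^*)^{p^e}`. -/
def kerPoly {K : Type*} [Field K] (p e : ℕ) (c : ℕ → K) : K[X] :=
  ∑ i ∈ Finset.Icc 1 e, (C (c i ^ p ^ e) * X ^ p ^ (i + e) + C (c i ^ p ^ (e - i)) * X ^ p ^ (e - i))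

theorem aeval_kerPoly {K L : Type*} [Field K] [Field L] [CharP L 2] [Algebra K L] (k e : ℕ)
    (c : ℕ → K) (u : L) (r : ℕ → L) (hr : ∀ i, r i ^ (2 ^ k) ^ i = algebraMap K L (c i) * u) :
    Polynomial.aeval u (kerPoly (2 ^ k) e c) =
      (∑ i ∈ Finset.Icc 1 e, algebraMap K L (c i) * u ^ (2 ^ k) ^ i
        + ∑ i ∈ Finset.Icc 1 e, r i) ^ (2 ^ k) ^ e := by
  haveI : ExpChar L 2 := ExpChar.prime Nat.prime_two
  rw [← Finset.sum_add_distrib, ← pow_mul 2 k e, sum_pow_char_pow, kerPoly, map_sum]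
  refine Finset.sum_congr rfl fun i hi => ?_
  rw [Finset.mem_Icc] at hi
  rw [add_pow_expChar_pow]
  simp only [map_add, map_mul, map_pow, Polynomial.aeval_X, Polynomial.aeval_C]
  congr 1
  · rw [mul_pow, ← pow_mul u, ← pow_mul 2 k e, ← pow_mul 2 k i, ← pow_mul 2 k, ← pow_add, mul_add]
  · rw [← mul_pow, ← hr i, ← pow_mul, ← pow_add, ← pow_mul]
    congr 3; omega

theorem kerPoly_separable {K : Type*} [Field K] [CharP K 2] (k e : ℕ) (hk : 1 ≤ k) (he : 1 ≤ e)
    (c : ℕ → K) (hc : c e ≠ 0) : (kerPoly (2 ^ k) e c).Separable := by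
  have hz : ∀ j, 1 ≤ j → (((2 ^ k) ^ j : ℕ) : K) = 0 := by
    intro j hj
    rw [Nat.cast_pow, Nat.cast_pow, Nat.cast_ofNat, CharTwo.two_eq_zero, zero_pow (by omega),
      zero_pow (by omega)]
  have hd : Polynomial.derivative (kerPoly (2 ^ k) e c) = Polynomial.C (c e) := by
    rw [kerPoly, Polynomial.derivative_sum, Finset.sum_eq_single e]
    · rw [Polynomial.derivative_add, Polynomial.derivative_C_mul_X_pow,
        Polynomial.derivative_C_mul_X_pow, hz _ (by omega)]
      simp
    · intro i hi hie
      rw [Finset.mem_Icc] at hi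
      rw [Polynomial.derivative_add, Polynomial.derivative_C_mul_X_pow,
        Polynomial.derivative_C_mul_X_pow, hz _ (by omega), hz _ (by omega)]
      simp
    · intro h; exact absurd (Finset.mem_Icc.2 ⟨he, le_refl _⟩) h
  rw [Polynomial.separable_def, hd]
  exact isCoprime_of_isUnit_right (Polynomial.isUnit_C.2 hc.isUnit)
where
  isCoprime_of_isUnit_right {R : Type _} [CommRing R] {a b : R} (h : IsUnit b) : IsCoprime a b :=
    (isCoprime_of_isUnit_left' h).symm
  isCoprime_of_isUnit_left' {R : Type _} [CommRing R] {a b : R} (h : IsUnit b) : IsCoprime b a := by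
    obtain ⟨v, hv⟩ := h.exists_left_inv
    exact ⟨v, 0, by rw [hv]; ring⟩

theorem kerPoly_natDegree {K : Type*} [Field K] (k e : ℕ) (hk : 1 ≤ k) (he : 1 ≤ e)
    (c : ℕ → K) (hc : c e ≠ 0) : (kerPoly (2 ^ k) e c).natDegree = (2 ^ k) ^ (2 * e) := by
  have h1 : 1 < 2 ^ k := Nat.one_lt_two_pow (by omega)
  apply le_antisymm
  · apply Polynomial.natDegree_sum_le_of_forall_le
    intro i hi
    rw [Finset.mem_Icc] at hi
    refine (Polynomial.natDegree_add_le _ _).trans (max_le ?_ ?_) <;>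
    · refine (Polynomial.natDegree_C_mul_X_pow_le _ _).trans ?_
      exact Nat.pow_le_pow_right (by omega) (by omega)
  · apply Polynomial.le_natDegree_of_ne_zero
    rw [kerPoly, Polynomial.finsetSum_coeff, Finset.sum_eq_single e]
    · rw [Polynomial.coeff_add, Polynomial.coeff_C_mul_X_pow, Polynomial.coeff_C_mul_X_pow,
        if_pos (by rw [two_mul]), if_neg, add_zero]
      · exact pow_ne_zero _ hc
      · intro h
        have := Nat.pow_right_injective h1 h
        omega
    · intro i hi hie
      rw [Finset.mem_Icc] at hi
      rw [Polynomial.coeff_add, Polynomial.coeff_C_mul_X_pow, Polynomial.coeff_C_mul_X_pow,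
        if_neg, if_neg, add_zero]
      all_goals
        intro h
        have := Nat.pow_right_injective h1 h
        omega
    · intro h; exact absurd (Finset.mem_Icc.2 ⟨he, le_refl _⟩) h

/-- The endomorphism `R + R^*` of `K`. -/
def kerMap (F : Type*) {K : Type*} [Field F] [Field K] [Algebra F K] (φ : K ≃ₐ[F] K) (e : ℕ)
    (c : ℕ → K) : K →ₗ[F] K :=
  ∑ i ∈ Finset.Icc 1 e, (LinearMap.mulLeft F (c i) ∘ₗ (φ ^ i).toLinearMap
    + (φ ^ i).symm.toLinearMap ∘ₗ LinearMap.mulLeft F (c i))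

theorem kerMap_apply {F K : Type*} [Field F] [Field K] [Algebra F K] (φ : K ≃ₐ[F] K) (e : ℕ)
    (c : ℕ → K) (x : K) : kerMap F φ e c x =
      ∑ i ∈ Finset.Icc 1 e, c i * (φ ^ i) x + ∑ i ∈ Finset.Icc 1 e, (φ ^ i).symm (c i * x) := by
  simp [kerMap, Finset.sum_add_distrib]

theorem kerMap_alt {F K : Type*} [Field F] [Field K] [CharP K 2] [Algebra F K]
    (φ : K ≃ₐ[F] K) (e : ℕ)
    (c : ℕ → K) (x : K) : Algebra.trace F K (kerMap F φ e c x * x) = 0 := by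
  haveI : CharP F 2 := (Algebra.charP_iff F K 2).2 inferInstance
  rw [kerMap_apply, add_mul, Finset.sum_mul, Finset.sum_mul, ← Finset.sum_add_distrib, map_sum]
  refine Finset.sum_eq_zero fun i _ => ?_
  rw [map_add]
  have : Algebra.trace F K ((φ ^ i).symm (c i * x) * x)
      = Algebra.trace F K (c i * (φ ^ i) x * x) := by
    rw [← Algebra.trace_eq_of_algEquiv (φ ^ i), map_mul, AlgEquiv.apply_symm_apply]
    congr 1; ring
  rw [this, CharTwo.add_self_eq_zero]

theorem main_aux {F K : Type*} [Field F] [Fintype F] [Field K] [Fintype K] [CharP K 2]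
    [Algebra F K] (k m e : ℕ) (hk : 1 ≤ k) (he : 1 ≤ e) (hF : Fintype.card F = 2 ^ k)
    (hcard : Fintype.card K = 2 ^ (k * m))
    (c : ℕ → K) (hce : c e ≠ 0)
    (hV : ∀ u : AlgebraicClosure K, Polynomial.aeval u (kerPoly (2 ^ k) e c) = 0 →
        u ∈ Set.range (algebraMap K (AlgebraicClosure K))) : Even m := by
  let φ := FiniteField.frobeniusAlgEquivOfAlgebraic F K
  have hφ : ∀ i x, (φ ^ i) x = x ^ (2 ^ k) ^ i := by
    intro i x
    rw [AlgEquiv.coe_pow, FiniteField.coe_frobeniusAlgEquivOfAlgebraic, hF, pow_iterate]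
  haveI : FiniteDimensional F K := Module.Finite.of_finite
  let S := kerMap F φ e c
  let B : K →ₗ[F] K →ₗ[F] F := (Algebra.traceForm F K) ∘ₗ S
  have hB : ∀ x y, B x y = Algebra.trace F K (S x * y) := fun x y => rfl
  have hpar := alt_parity_aux _ B (fun x => by rw [hB]; exact kerMap_alt φ e c x) rfl
  have hker : LinearMap.ker B = LinearMap.ker S := by
    apply LinearMap.ker_comp_of_ker_eq_bot
    exact LinearMap.BilinForm.Nondegenerate.ker_eq_bot (traceForm_nondegenerate F K)
  have hS : ∀ x, S x = 0 ↔ Polynomial.aeval x (kerPoly (2 ^ k) e c) = 0 := by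
    intro x
    rw [aeval_kerPoly k e c x (fun i => (φ ^ i).symm (c i * x))
      (fun i => by rw [← hφ, AlgEquiv.apply_symm_apply]; rfl)]
    rw [pow_eq_zero_iff (by positivity), kerMap_apply]
    simp only [hφ]; rfl
  have hP0 : kerPoly (2 ^ k) e c ≠ 0 := (kerPoly_separable k e hk he c hce).ne_zero
  have hcardker : Nat.card (LinearMap.ker S) = (2 ^ k) ^ (2 * e) := by
    have h1 := Polynomial.card_rootSet_eq_natDegree (K := AlgebraicClosure K)
      (kerPoly_separable k e hk he c hce) (IsAlgClosed.splits _)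
    rw [kerPoly_natDegree k e hk he c hce, ← Nat.card_eq_fintype_card] at h1
    rw [← h1]
    have h2 : (kerPoly (2 ^ k) e c).rootSet (AlgebraicClosure K)
        = algebraMap K (AlgebraicClosure K) '' (LinearMap.ker S : Set K) := by
      ext u
      rw [Polynomial.mem_rootSet_of_ne hP0]
      constructor
      · intro h
        obtain ⟨x, rfl⟩ := hV u h
        refine ⟨x, ?_, rfl⟩
        rw [Polynomial.aeval_algebraMap_apply, map_eq_zero] at h
        exact (hS x).2 h
      · rintro ⟨x, hx, rfl⟩
        rw [Polynomial.aeval_algebraMap_apply, (hS x).1 hx, map_zero]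
    rw [h2, Nat.card_image_of_injective (algebraMap K (AlgebraicClosure K)).injective]
    rfl
  have hkerrank : Module.finrank F (LinearMap.ker S) = 2 * e := by
    have := Module.natCard_eq_pow_finrank (K := F) (V := LinearMap.ker S)
    rw [hcardker, Nat.card_eq_fintype_card, hF] at this
    exact (Nat.pow_right_injective (Nat.one_lt_two_pow (by omega) : 2 ≤ 2 ^ k) this).symm
  have hKrank : Module.finrank F K = m := by
    have := Module.natCard_eq_pow_finrank (K := F) (V := K)
    rw [Nat.card_eq_fintype_card, Nat.card_eq_fintype_card, hF, hcard, pow_mul] at this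
    exact (Nat.pow_right_injective (Nat.one_lt_two_pow (by omega) : 2 ≤ 2 ^ k) this).symm
  rw [hker, hkerrank, hKrank] at hpar
  rw [Nat.even_iff] at hpar ⊢
  omega

theorem rt_pow {L : Type*} [Field L] [ExpChar L 2] [PerfectRing L 2] (j : ℕ) (x : L) :
    rt L j x ^ 2 ^ j = x := by
  induction j generalizing x with
  | zero => simp [rt]
  | succ n ih =>
    have : rt L (n + 1) x = rt L n ((frobeniusEquiv L 2).symm x) := rfl
    rw [this, pow_succ, pow_mul, ih, frobeniusEquiv_symm_pow_p]

/-- If `ker(R + R^*) ⊆ 𝔽_q`, then `[𝔽_q : 𝔽_p]` is even. -/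
theorem statement5 {K : Type*} [Field K] [Fintype K] [CharP K 2]
    (k m e : ℕ) (hk : 1 ≤ k) (hm : 1 ≤ m) (he : 1 ≤ e)
    (hcard : Fintype.card K = 2 ^ (k * m))
    (c : ℕ → K) (hce : c e ≠ 0)
    (hV : ∀ u : AlgebraicClosure K,
      LpolyIcc (2 ^ k) e (fun i => algebraMap K (AlgebraicClosure K) (c i)) u
          + adjIcc k e (fun i => algebraMap K (AlgebraicClosure K) (c i)) u = 0 →
        u ∈ Set.range (algebraMap K (AlgebraicClosure K))) :
    Even m := by
  haveI : Fact (Nat.Prime 2) := ⟨Nat.prime_two⟩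
  letI : Algebra (ZMod 2) K := ZMod.algebra K 2
  have hd : Module.finrank (ZMod 2) (GaloisField 2 k) ∣ Module.finrank (ZMod 2) K := by
    have h := Module.natCard_eq_pow_finrank (K := ZMod 2) (V := K)
    rw [Nat.card_eq_fintype_card, hcard, Nat.card_eq_fintype_card, ZMod.card] at h
    rw [GaloisField.finrank 2 (by omega), ← Nat.pow_right_injective (le_refl 2) h]
    exact dvd_mul_right _ _
  obtain ⟨f⟩ := FiniteField.nonempty_algHom_of_finrank_dvd hd
  letI : Algebra (GaloisField 2 k) K := f.toRingHom.toAlgebra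
  haveI : Fintype (GaloisField 2 k) := Fintype.ofFinite _
  refine main_aux (F := GaloisField 2 k) k m e hk he ?_ hcard c hce fun u hu => hV u ?_
  · rw [← Nat.card_eq_fintype_card]; exact GaloisField.card 2 k (by omega)
  · rw [aeval_kerPoly k e c u
      (fun i => rt (AlgebraicClosure K) (k * i) (algebraMap K (AlgebraicClosure K) (c i) * u))
      (fun i => by rw [← pow_mul 2 k i, rt_pow]), pow_eq_zero_iff (by positivity)] at hu
    exact hu

end
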